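/- For every real t > 0, (1/t) ∫_ℝ e^{−y²/(2t)} · ((y/2)/sinh(y/2)) · (2πt)^{−1/2} dy = (1/2) ∫_ℝ e^{−tρ²/2} ρ tanh(πρ) dρ, where both integrals converge absolutely. (Equation (2.4.27) of the paper; it matches Bismut's orbital integral formula for the identity element in SL₂(ℝ) with Harish-Chandra's Plancherel formula.) -/

import Mathlib

open Real MeasureTheory

lemma Real.mul_one_add_sq_le_sinh {x : ℝ} (hx : 0 ≤ x) :
    x * (1 + x ^ 2 / 8) ≤ sinh x := by
  have h1 : x / 2 ≤ sinh (x / 2) := self_le_sinh_iff.2 (by positivity)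
  have h2 : x / 4 ≤ sinh (x / 4) := self_le_sinh_iff.2 (by positivity)
  have h3 : cosh (x / 2) = 1 + 2 * sinh (x / 4) ^ 2 := by
    rw [show x / 2 = 2 * (x / 4) by ring, cosh_two_mul, cosh_sq]; ring
  have h4 : 1 + x ^ 2 / 8 ≤ cosh (x / 2) := by rw [h3]; nlinarith
  calc x * (1 + x ^ 2 / 8) = 2 * (x / 2) * (1 + x ^ 2 / 8) := by ring
    _ ≤ 2 * sinh (x / 2) * cosh (x / 2) := by gcongr
    _ = sinh x := by rw [← sinh_two_mul]; ring_nf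

lemma Real.abs_div_sinh_le (x : ℝ) : |x / sinh x| ≤ (1 + x ^ 2 / 8)⁻¹ := by
  wlog hx : 0 ≤ x generalizing x
  · simpa using this (-x) (by linarith)
  rcases hx.eq_or_lt with rfl | hx
  · simp
  · have hs : 0 < sinh x := sinh_pos_iff.2 hx
    rw [abs_of_pos (by positivity), div_le_iff₀ hs, inv_mul_eq_div, le_div_iff₀ (by positivity)]
    exact mul_one_add_sq_le_sinh hx.le

lemma Real.integrable_div_sinh : Integrable (fun x : ℝ => x / sinh x) := by
  have h : Integrable fun x : ℝ => (1 + (x / 3) ^ 2)⁻¹ :=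
    integrable_inv_one_add_sq.comp_div (by norm_num)
  refine h.mono' (measurable_id.div measurable_sinh).aestronglyMeasurable
    (ae_of_all _ fun x => (abs_div_sinh_le x).trans ?_)
  gcongr
  nlinarith [sq_nonneg x]

lemma Complex.hasSum_pi_mul_tan_pi_mul {z : ℂ} (hz : z ∈ Complex.integerComplement)
    (hz2 : 2 * z ∈ Complex.integerComplement) :
    HasSum (fun n : ℕ => -2 * z / (z ^ 2 - (n + 1 / 2) ^ 2)) (π * Complex.tan (π * z)) := by
  have hodd_term (n : ℕ) : 2 * cotTerm (2 * z) (2 * n + 1) = cotTerm z n := by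
    simp only [cotTerm]
    push_cast
    rw [show 2 * z - (2 * (n : ℂ) + 1 + 1) = 2 * (z - (n + 1)) by ring,
      show 2 * z + (2 * (n : ℂ) + 1 + 1) = 2 * (z + (n + 1)) by ring]
    simp only [one_div, mul_inv]
    ring
  have heven_term (n : ℕ) :
      -2 * cotTerm (2 * z) (2 * n) = -2 * z / (z ^ 2 - (n + 1 / 2) ^ 2) := by
    rw [cotTerm_identity hz2]
    push_cast
    rw [show (2 * z + (2 * (n : ℂ) + 1)) * (2 * z - (2 * n + 1)) =
      4 * (z ^ 2 - (n + 1 / 2) ^ 2) by ring]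
    simp only [one_div, mul_inv]
    ring
  have heven : Summable fun n => cotTerm (2 * z) (2 * n) :=
    (summable_cotTerm hz2).comp_injective (mul_right_injective₀ two_ne_zero)
  have hsplit := tsum_even_add_odd heven
    ((summable_cotTerm hz2).comp_injective (i := fun n => 2 * n + 1) fun a b h => by simpa using h)
  have hcot := cot_series_rep' hz
  have hcot2 := cot_series_rep' hz2
  have hodd : 2 * ∑' n : ℕ, cotTerm (2 * z) (2 * n + 1) = ∑' n : ℕ, cotTerm z n := by
    rw [← tsum_mul_left]
    exact tsum_congr hodd_term
  have hsin : Complex.sin (π * z) ≠ 0 := sin_pi_mul_ne_zero hz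
  have hsin2 : Complex.sin (π * (2 * z)) ≠ 0 := sin_pi_mul_ne_zero hz2
  have hdouble : (π : ℂ) * (2 * z) = 2 * (π * z) := by ring
  have hcos : Complex.cos (π * z) ≠ 0 := by
    intro h
    rw [hdouble, Complex.sin_two_mul, h] at hsin2
    simp at hsin2
  have htan : Complex.tan (π * z) = Complex.cot (π * z) - 2 * Complex.cot (π * (2 * z)) := by
    rw [hdouble, Complex.tan, Complex.cot, Complex.cot, Complex.sin_two_mul, Complex.cos_two_mul]
    field_simp
    linear_combination Complex.sin_sq_add_cos_sq (π * z)
  have hsum := heven.hasSum.mul_left (-2)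
  simp only [heven_term] at hsum
  have hinv : 1 / (2 * z) = 1 / z / 2 := by field_simp
  rw [hinv] at hcot2
  have hval : π * Complex.tan (π * z) = -2 * ∑' n : ℕ, cotTerm (2 * z) (2 * n) := by
    rw [htan]
    linear_combination hcot - 2 * hcot2 + 2 * hsplit - hodd
  rwa [hval]

lemma Real.hasSum_pi_mul_tanh_pi_mul (x : ℝ) :
    HasSum (fun n : ℕ => 2 * x / ((n + 1 / 2) ^ 2 + x ^ 2)) (π * tanh (π * x)) := by
  rcases eq_or_ne x 0 with rfl | hx
  · simp [hasSum_zero]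
  have hmem {y : ℝ} (hy : y ≠ 0) : (y * Complex.I : ℂ) ∈ Complex.integerComplement := by
    rintro ⟨n, hn⟩
    exact hy (by simpa using (congrArg Complex.im hn).symm)
  have h := Complex.hasSum_pi_mul_tan_pi_mul (z := x * Complex.I) (hmem hx)
    (by simpa [mul_assoc] using hmem (y := 2 * x) (by simpa using hx))
  rw [← mul_assoc (π : ℂ), Complex.tan_mul_I] at h
  have h' := h.mul_right (-Complex.I)
  have hterm (n : ℕ) : -2 * (x * Complex.I) / ((x * Complex.I) ^ 2 - (n + 1 / 2) ^ 2) *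
      -Complex.I = ((2 * x / ((n + 1 / 2) ^ 2 + x ^ 2) : ℝ) : ℂ) := by
    push_cast
    rw [mul_pow, Complex.I_sq, show (x : ℂ) ^ 2 * -1 - (n + 1 / 2) ^ 2 =
      -((n + 1 / 2) ^ 2 + (x : ℂ) ^ 2) by ring, div_neg]
    linear_combination -(2 * x / ((n + 1 / 2) ^ 2 + (x : ℂ) ^ 2)) * Complex.I_sq
  have hval : π * (Complex.tanh (π * x) * Complex.I) * -Complex.I =
      ((π * tanh (π * x) : ℝ) : ℂ) := by
    push_cast
    linear_combination -(π * Complex.tanh (π * x)) * Complex.I_sq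
  simp only [hterm, hval] at h'
  exact Complex.hasSum_ofReal.1 h'

lemma Real.integral_sin_mul_exp_neg_mul_Ioi (ρ : ℝ) {a : ℝ} (ha : 0 < a) :
    ∫ y in Set.Ioi (0 : ℝ), sin (ρ * y) * exp (-a * y) = ρ / (a ^ 2 + ρ ^ 2) := by
  have hre : (-a + ρ * Complex.I : ℂ).re < 0 := by simpa using ha
  have h := congrArg Complex.im (integral_exp_mul_complex_Ioi hre 0)
  have him := integral_im (𝕜 := ℂ) (integrableOn_exp_mul_complex_Ioi hre 0)
  simp only [RCLike.im_to_complex] at him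
  rw [← him] at h
  convert h using 1
  · congr 1 with y
    simp [Complex.exp_im, mul_comm]
  · simp [Complex.div_im, Complex.normSq_apply]
    ring

lemma Real.integral_mul_exp_neg_mul_Ioi {a : ℝ} (ha : 0 < a) :
    ∫ y in Set.Ioi (0 : ℝ), y * exp (-a * y) = 1 / a ^ 2 := by
  have h := integral_rpow_mul_exp_neg_mul_Ioi (a := 2) two_pos ha
  norm_num [Gamma_two] at h
  simpa using h

lemma Real.integrableOn_mul_exp_neg_mul_Ioi {a : ℝ} (ha : 0 < a) :
    IntegrableOn (fun y : ℝ => y * exp (-a * y)) (Set.Ioi 0) := by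
  simpa using integrableOn_rpow_mul_exp_neg_mul_rpow (s := 1) (p := 1) (by norm_num) one_pos ha

lemma Real.hasSum_two_mul_exp_neg_mul {y : ℝ} (hy : 0 < y) :
    HasSum (fun n : ℕ => 2 * exp (-(n + 1 / 2) * y)) (1 / sinh (y / 2)) := by
  have hlt : exp (-y) < 1 := exp_lt_one_iff.2 (by linarith)
  have h := (hasSum_geometric_of_lt_one (exp_pos (-y)).le hlt).mul_left (2 * exp (-(y / 2)))
  have hs : sinh (y / 2) ≠ 0 := (sinh_pos_iff.2 (by positivity)).ne'
  have he : 1 - exp (-y) ≠ 0 := (sub_pos.2 hlt).ne'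
  have hterm (n : ℕ) : 2 * exp (-(y / 2)) * exp (-y) ^ n = 2 * exp (-(n + 1 / 2) * y) := by
    rw [← exp_nat_mul, mul_assoc, ← exp_add]
    ring_nf
  have hval : 2 * exp (-(y / 2)) * (1 - exp (-y))⁻¹ = 1 / sinh (y / 2) := by
    rw [← div_eq_mul_inv, div_eq_div_iff he hs, sinh_eq, show -y = -(y / 2) + -(y / 2) by ring,
      exp_add]
    have : exp (y / 2) * exp (-(y / 2)) = 1 := by rw [← exp_add]; simp
    linear_combination this
  simpa only [hterm, hval] using h

lemma Real.integral_sin_mul_div_sinh_Ioi (ρ : ℝ) :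
    ∫ y in Set.Ioi (0 : ℝ), sin (ρ * y) / sinh (y / 2) = π * tanh (π * ρ) := by
  have hpos (n : ℕ) : (0 : ℝ) < n + 1 / 2 := by positivity
  have hdom (n : ℕ) : IntegrableOn
      (fun y : ℝ => 2 * |ρ| * (y * exp (-(n + 1 / 2 : ℝ) * y))) (Set.Ioi 0) :=
    (integrableOn_mul_exp_neg_mul_Ioi (hpos n)).const_mul _
  have hle (n : ℕ) : ∀ y ∈ Set.Ioi (0 : ℝ), ‖sin (ρ * y) * (2 * exp (-(n + 1 / 2 : ℝ) * y))‖ ≤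
      2 * |ρ| * (y * exp (-(n + 1 / 2 : ℝ) * y)) := fun y hy => by
    have hsin : |sin (ρ * y)| ≤ |ρ| * y := by
      simpa [abs_mul, abs_of_pos (Set.mem_Ioi.1 hy)] using abs_sin_le_abs (x := ρ * y)
    rw [norm_mul, norm_eq_abs, norm_of_nonneg (by positivity)]
    calc _ ≤ |ρ| * y * (2 * exp (-(n + 1 / 2 : ℝ) * y)) := by gcongr
      _ = _ := by ring
  have hF (n : ℕ) : IntegrableOn
      (fun y : ℝ => sin (ρ * y) * (2 * exp (-(n + 1 / 2 : ℝ) * y))) (Set.Ioi 0) :=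
    (hdom n).mono' (by fun_prop) ((ae_restrict_iff' measurableSet_Ioi).2 (ae_of_all _ (hle n)))
  have hsummable : Summable fun n : ℕ => 2 * |ρ| * (1 / ((n : ℝ) + 1 / 2) ^ 2) := by
    refine Summable.mul_left _ ?_
    simpa using (summable_one_div_nat_add_rpow (1 / 2) 2).2 one_lt_two
  have hbound (n : ℕ) :
      ∫ y in Set.Ioi (0 : ℝ), ‖sin (ρ * y) * (2 * exp (-(n + 1 / 2 : ℝ) * y))‖ ≤
        2 * |ρ| * (1 / ((n : ℝ) + 1 / 2) ^ 2) := by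
    rw [← integral_mul_exp_neg_mul_Ioi (hpos n), ← integral_const_mul]
    exact setIntegral_mono_on (hF n).norm (hdom n) measurableSet_Ioi (hle n)
  have h := hasSum_integral_of_summable_integral_norm hF
    (Summable.of_nonneg_of_le (fun n => integral_nonneg fun _ => norm_nonneg _) hbound hsummable)
  have hterm (n : ℕ) : ∫ y in Set.Ioi (0 : ℝ), sin (ρ * y) * (2 * exp (-(n + 1 / 2 : ℝ) * y)) =
      2 * ρ / ((n + 1 / 2) ^ 2 + ρ ^ 2) := by
    rw [mul_div_assoc, ← integral_sin_mul_exp_neg_mul_Ioi ρ (hpos n), ← integral_const_mul]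
    congr 1 with y
    ring
  simp only [hterm] at h
  rw [(hasSum_pi_mul_tanh_pi_mul ρ).unique h]
  refine setIntegral_congr_fun measurableSet_Ioi fun y hy => ?_
  rw [tsum_mul_left, (hasSum_two_mul_exp_neg_mul hy).tsum_eq, mul_one_div]

lemma Real.integral_sin_mul_div_sinh (ρ : ℝ) :
    ∫ y : ℝ, sin (ρ * y) / sinh (y / 2) = 2 * π * tanh (π * ρ) := by
  rw [mul_assoc, ← integral_sin_mul_div_sinh_Ioi, ← integral_comp_abs]
  congr 1 with y
  rcases abs_choice y with h | h <;> simp [h, neg_div, div_neg]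

lemma Real.integral_exp_neg_mul_sq_mul_cos {b : ℝ} (hb : 0 < b) (y : ℝ) :
    ∫ x : ℝ, exp (-b * x ^ 2) * cos (x * y) = √(π / b) * exp (-y ^ 2 / (4 * b)) := by
  have hb' : 0 < (b : ℂ).re := by simpa using hb
  have hF : Integrable fun x : ℝ =>
      Complex.exp (Complex.I * y * x) * Complex.exp (-b * (x : ℂ) ^ 2) := by
    simpa [← Complex.exp_add, add_comm] using
      integrable_cexp_quadratic hb' (Complex.I * y) 0
  have h := congrArg Complex.re (fourierIntegral_gaussian hb' (y : ℂ))
  have hre := integral_re (𝕜 := ℂ) hF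
  simp only [RCLike.re_to_complex] at hre
  rw [← hre] at h
  convert h using 1
  · congr 1 with x
    have h1 : Complex.exp (-b * (x : ℂ) ^ 2) = (exp (-b * x ^ 2) : ℝ) := by push_cast; rfl
    rw [h1, Complex.re_mul_ofReal, Complex.exp_re]
    simp [mul_comm]
  · have h1 : Complex.exp (-(y : ℂ) ^ 2 / (4 * b)) = (exp (-y ^ 2 / (4 * b)) : ℝ) := by
      push_cast; rfl
    have h2 : ((π : ℂ) / b) ^ (1 / 2 : ℂ) = (√(π / b) : ℝ) := by
      rw [sqrt_eq_rpow, Complex.ofReal_cpow (by positivity)]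
      push_cast; rfl
    rw [h1, h2, ← Complex.ofReal_mul, Complex.ofReal_re]

lemma Real.integral_mul_exp_neg_mul_sq_mul_sin {b : ℝ} (hb : 0 < b) (y : ℝ) :
    ∫ x : ℝ, exp (-b * x ^ 2) * x * sin (x * y) =
      y / (2 * b) * (√(π / b) * exp (-y ^ 2 / (4 * b))) := by
  have hu (x : ℝ) :
      HasDerivAt (fun x => exp (-b * x ^ 2)) (exp (-b * x ^ 2) * (-b * (2 * x))) x := by
    simpa using ((hasDerivAt_pow 2 x).const_mul (-b)).exp
  have hv (x : ℝ) : HasDerivAt (fun x => sin (x * y)) (cos (x * y) * y) x := by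
    simpa using ((hasDerivAt_id x).mul_const y).sin
  have hexp := integrable_exp_neg_mul_sq hb
  have h := integral_mul_deriv_eq_deriv_mul_of_integrable (fun x _ => hu x) (fun x _ => hv x)
    (hexp.mul_bdd (c := |y|) (by fun_prop) (ae_of_all _ fun x => by
      rw [norm_mul]
      exact mul_le_of_le_one_left (abs_nonneg y) (abs_cos_le_one _)))
    (((integrable_mul_exp_neg_mul_sq hb).const_mul (-2 * b)).congr (ae_of_all _ fun x => by
      simp only; ring) |>.mul_bdd (c := 1) (by fun_prop) (ae_of_all _ fun x => abs_sin_le_one _))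
    (hexp.mul_bdd (c := 1) (by fun_prop) (ae_of_all _ fun x => abs_sin_le_one _))
  have hl : ∫ x : ℝ, exp (-b * x ^ 2) * (cos (x * y) * y) =
      y * (√(π / b) * exp (-y ^ 2 / (4 * b))) := by
    rw [← integral_exp_neg_mul_sq_mul_cos hb, ← integral_const_mul]
    congr 1 with x
    ring
  have hr : ∫ x : ℝ, exp (-b * x ^ 2) * (-b * (2 * x)) * sin (x * y) =
      -(2 * b) * ∫ x : ℝ, exp (-b * x ^ 2) * x * sin (x * y) := by
    rw [← integral_const_mul]
    congr 1 with x
    ring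
  rw [hl, hr] at h
  rw [div_mul_eq_mul_div, h, neg_mul, neg_neg, mul_div_cancel_left₀ _ (by positivity)]

lemma Real.integrable_sq_mul_exp_neg_mul_sq {b : ℝ} (hb : 0 < b) :
    Integrable fun x : ℝ => x ^ 2 * exp (-b * x ^ 2) := by
  simpa using integrable_rpow_mul_exp_neg_mul_sq hb (s := 2) (by norm_num)

lemma Real.integrable_exp_neg_mul_sq_mul_sin_div_sinh {b : ℝ} (hb : 0 < b) :
    Integrable (fun p : ℝ × ℝ =>
      exp (-b * p.1 ^ 2) * p.1 * (sin (p.1 * p.2) / sinh (p.2 / 2))) (volume.prod volume) := by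
  have hdom := ((integrable_sq_mul_exp_neg_mul_sq hb).mul_prod
    (integrable_div_sinh.comp_div (R := 2) two_ne_zero)).const_mul 2
  refine hdom.mono (Measurable.aestronglyMeasurable (by fun_prop)) (ae_of_all _ fun ⟨x, y⟩ => ?_)
  have hsin : |sin (x * y)| ≤ |x * y| := abs_sin_le_abs
  simp only [norm_mul, norm_div, norm_eq_abs, abs_exp, abs_pow, abs_two]
  calc _ ≤ exp (-b * x ^ 2) * |x| * (|x * y| / |sinh (y / 2)|) := by gcongr
    _ = _ := by rw [abs_mul]; ring

/-- Equation (2.4.27): for every `t > 0`,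
`(1/t) ∫_ℝ e^{-y²/(2t)} ((y/2)/sinh(y/2)) (2πt)^{-1/2} dy
  = (1/2) ∫_ℝ e^{-tρ²/2} ρ tanh(πρ) dρ`,
where the integrand `(y/2)/sinh(y/2)` is extended by its limit value `1` at `y = 0`,
and both integrals converge absolutely. -/
theorem bismut_plancherel_sl2_identity (t : ℝ) (ht : 0 < t) :
    Integrable (fun y : ℝ =>
      Real.exp (-y ^ 2 / (2 * t)) *
        (if y = 0 then 1 else (y / 2) / Real.sinh (y / 2)) *
        (2 * π * t) ^ (-(1 : ℝ) / 2)) ∧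
    Integrable (fun ρ : ℝ => Real.exp (-t * ρ ^ 2 / 2) * ρ * Real.tanh (π * ρ)) ∧
    (1 / t) * ∫ y : ℝ,
        Real.exp (-y ^ 2 / (2 * t)) *
          (if y = 0 then 1 else (y / 2) / Real.sinh (y / 2)) *
          (2 * π * t) ^ (-(1 : ℝ) / 2)
      = (1 / 2) * ∫ ρ : ℝ, Real.exp (-t * ρ ^ 2 / 2) * ρ * Real.tanh (π * ρ) := by
  have hb : 0 < t / 2 := by positivity
  have hae : (fun y : ℝ => exp (-y ^ 2 / (2 * t)) * ((y / 2) / sinh (y / 2)) *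
      (2 * π * t) ^ (-(1 : ℝ) / 2)) =ᵐ[volume] fun y : ℝ => exp (-y ^ 2 / (2 * t)) *
        (if y = 0 then 1 else (y / 2) / sinh (y / 2)) * (2 * π * t) ^ (-(1 : ℝ) / 2) := by
    filter_upwards [Measure.ae_ne volume 0] with y hy
    rw [if_neg hy]
  have hexp (ρ : ℝ) : exp (-t * ρ ^ 2 / 2) = exp (-(t / 2) * ρ ^ 2) := by ring_nf
  simp only [hexp]
  refine ⟨Integrable.congr ?_ hae, ?_, ?_⟩
  · refine ((integrable_div_sinh.comp_div two_ne_zero).bdd_mul (c := 1) (by fun_prop)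
      (ae_of_all _ fun y => ?_)).mul_const _
    rw [norm_of_nonneg (exp_pos _).le, exp_le_one_iff, neg_div]
    exact neg_nonpos.2 (by positivity)
  · refine ((integrable_mul_exp_neg_mul_sq hb).congr (ae_of_all _ fun ρ => mul_comm _ _)).mul_bdd
      (c := 1) (by
        simp only [tanh_eq_sinh_div_cosh]
        exact Measurable.aestronglyMeasurable (by fun_prop)) (ae_of_all _ fun ρ => ?_)
    exact (abs_tanh_lt_one _).le
  · have hswap := integral_integral_swap
      (f := fun x y : ℝ => exp (-(t / 2) * x ^ 2) * x * (sin (x * y) / sinh (y / 2)))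
      (integrable_exp_neg_mul_sq_mul_sin_div_sinh hb)
    simp only [integral_const_mul, integral_sin_mul_div_sinh] at hswap
    have hl : ∫ ρ : ℝ, exp (-(t / 2) * ρ ^ 2) * ρ * (2 * π * tanh (π * ρ)) =
        2 * π * ∫ ρ : ℝ, exp (-(t / 2) * ρ ^ 2) * ρ * tanh (π * ρ) := by
      rw [← integral_const_mul]
      congr 1 with ρ
      ring
    have hrpow : (2 * π * t) ^ (-(1 : ℝ) / 2) = √(π / (t / 2)) / (2 * π) := by
      rw [neg_div, rpow_neg (by positivity), ← sqrt_eq_rpow,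
        show π / (t / 2) = (2 * π) ^ 2 / (2 * π * t) by field_simp,
        sqrt_div (by positivity), sqrt_sq (by positivity)]
      field_simp
    have hr : ∫ y : ℝ, ∫ x : ℝ, exp (-(t / 2) * x ^ 2) * x * (sin (x * y) / sinh (y / 2)) =
        4 * π / t * ∫ y : ℝ, exp (-y ^ 2 / (2 * t)) * ((y / 2) / sinh (y / 2)) *
          (2 * π * t) ^ (-(1 : ℝ) / 2) := by
      rw [← integral_const_mul]
      congr 1 with y
      simp only [← mul_div_assoc]
      rw [integral_div, integral_mul_exp_neg_mul_sq_mul_sin hb, hrpow,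
        show 4 * (t / 2) = 2 * t by ring]
      field_simp
      ring
    rw [hl, hr] at hswap
    rw [← integral_congr_ae hae]
    rw [one_div_mul_eq_div, div_eq_iff ht.ne']
    rw [div_mul_eq_mul_div, eq_div_iff ht.ne'] at hswap
    refine mul_left_cancel₀ (mul_ne_zero four_ne_zero pi_ne_zero) ?_
    rw [← hswap]
    ring
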